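/- arXiv:2108.03297 — 5 statements merged into one kernel-verified Lean document; each statement's English description precedes it below -/
import Mathlib

section
/- Let S and S̄ be finite types (states), A a nonempty finite type (actions), K ∈ ℕ a horizon, and proj : S → S̄. Let tr : S → A → S → ℝ and tr' : S̄ → A → S̄ → ℝ be transition kernels and rwd : S → A → S → ℝ, rwd' : S̄ → A → S̄ → ℝ reward functions such that: (i) for every s̄' ∈ S̄, every a ∈ A, and every s ∈ S, tr'(proj s, a, s̄') = ∑_{s' : proj s' = s̄'} tr(s, a, s'); and (ii) rwd(s, a, s') = rwd'(proj s, a, proj s') for all s, a, s'. Define the optimal state-action value functions backward in time by Q_K(s,a) = 0 and, for i < K, Q_i(s,a) = ∑_{s'∈S} tr(s,a,s')·[rwd(s,a,s') + max_{a'∈A} Q_{i+1}(s',a')], and analogously Q̄_K(s̄,a) = 0 and Q̄_i(s̄,a) = ∑_{s̄'∈S̄} tr'(s̄,a,s̄')·[rwd'(s̄,a,s̄') + max_{a'∈A} Q̄_{i+1}(s̄',a')]. Then Q_i(s,a) = Q̄_i(proj s, a) for every 0 ≤ i ≤ K, every s ∈ S, and every a ∈ A. -/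
/-- State aggregation for finite-horizon MDPs. If the transition kernel
and reward of the full MDP aggregate correctly under `proj`, then the optimal
state-action value functions, defined by the backward Bellman recursion with
horizon `K`, coincide: `Q i s a = Q̄ i (proj s) a` for all `i ≤ K`. -/
theorem stmt1
    {S Sbar A : Type*} [Fintype S] [Fintype Sbar] [Fintype A] [Nonempty A] [DecidableEq Sbar]
    (K : ℕ) (proj : S → Sbar)
    (tr : S → A → S → ℝ) (tr' : Sbar → A → Sbar → ℝ)
    (rwd : S → A → S → ℝ) (rwd' : Sbar → A → Sbar → ℝ)
    (htr : ∀ (sbar' : Sbar) (a : A) (s : S),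
      tr' (proj s) a sbar' = ∑ s' ∈ Finset.univ.filter (fun s' => proj s' = sbar'), tr s a s')
    (hrwd : ∀ (s : S) (a : A) (s' : S), rwd s a s' = rwd' (proj s) a (proj s'))
    (Q : ℕ → S → A → ℝ) (Qbar : ℕ → Sbar → A → ℝ)
    (hQK : ∀ s a, Q K s a = 0)
    (hQ : ∀ i, i < K → ∀ s a, Q i s a =
      ∑ s' : S, tr s a s' *
        (rwd s a s' + Finset.univ.sup' Finset.univ_nonempty (fun a' => Q (i + 1) s' a')))
    (hQbarK : ∀ sbar a, Qbar K sbar a = 0)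
    (hQbar : ∀ i, i < K → ∀ sbar a, Qbar i sbar a =
      ∑ sbar' : Sbar, tr' sbar a sbar' *
        (rwd' sbar a sbar' +
          Finset.univ.sup' Finset.univ_nonempty (fun a' => Qbar (i + 1) sbar' a'))) :
    ∀ i, i ≤ K → ∀ (s : S) (a : A), Q i s a = Qbar i (proj s) a := by
  intro i hi
  induction hi using Nat.decreasingInduction with
  | self => intro s a; rw [hQK, hQbarK]
  | of_succ i hi ih =>
    intro s a
    rw [hQ i hi, hQbar i hi]
    simp only [ih, hrwd]
    rw [← Finset.sum_fiberwise Finset.univ proj]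
    refine Finset.sum_congr rfl fun sbar' _ => ?_
    rw [htr, Finset.sum_mul]
    refine Finset.sum_congr rfl fun s' hs' => ?_
    rw [(Finset.mem_filter.mp hs').2]
end

section
/- Let (X, D) be a metric space and μ : X → ℝ a 1-Lipschitz function, i.e., |μ(x) − μ(x')| ≤ D(x, x') for all x, x' ∈ X. Let 𝓑 be a nonempty finite set of balls, where each B ∈ 𝓑 has a center c_B ∈ X, a radius r_B ≥ 0, a value v_B ∈ ℝ, and a confidence radius conf_B ≥ 0 satisfying the clean-run condition |v_B − μ(c_B)| ≤ r_B + conf_B. Define the pre-index I^pre(B) = v_B + r_B + conf_B and the index I(B) = r_B + min_{B'∈𝓑} (I^pre(B') + D(c_B, c_{B'})). Then for every B ∈ 𝓑 and every x ∈ X with D(x, c_B) ≤ r_B, it holds that I(B) ≥ μ(x). -/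
/-- In a clean run, the index of an active ball is an upper confidence
bound: for every ball `B` of the finite collection `𝓑` and every context `x` in `B`
(i.e. `D(x, c_B) ≤ r_B`), the index `I(B) = r_B + min_{B'} (I^pre(B') + D(c_B, c_{B'}))`
with `I^pre(B') = v_{B'} + r_{B'} + conf_{B'}` satisfies `I(B) ≥ μ(x)`. -/
theorem stmt4
    {X : Type*} [MetricSpace X] (μ : X → ℝ)
    (hLip : ∀ x x' : X, |μ x - μ x'| ≤ dist x x')
    {ι : Type*} [Fintype ι] [Nonempty ι]
    (c : ι → X) (r : ι → ℝ) (v : ι → ℝ) (conf : ι → ℝ)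
    (hr : ∀ B, 0 ≤ r B) (hconf : ∀ B, 0 ≤ conf B)
    (hclean : ∀ B, |v B - μ (c B)| ≤ r B + conf B)
    (Ipre : ι → ℝ) (hIpre : ∀ B, Ipre B = v B + r B + conf B)
    (I : ι → ℝ)
    (hI : ∀ B, I B = r B +
      Finset.univ.inf' Finset.univ_nonempty (fun B' => Ipre B' + dist (c B) (c B'))) :
    ∀ (B : ι) (x : X), dist x (c B) ≤ r B → μ x ≤ I B := by
  intro B x hx
  have hinf : μ (c B) ≤
      Finset.univ.inf' Finset.univ_nonempty (fun B' => Ipre B' + dist (c B) (c B')) := by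
    refine Finset.le_inf' _ _ fun B' _ => ?_
    have hcenter := (abs_le.mp (hLip (c B) (c B'))).2
    have hpre := (abs_le.mp (hclean B')).1
    rw [hIpre]
    linarith
  have hxB := (abs_le.mp (hLip x (c B))).2
  rw [hI]
  linarith
end

section
/- Let (X, D) be a metric space and μ : X → ℝ a 1-Lipschitz function, i.e., |μ(x) − μ(x')| ≤ D(x, x') for all x, x' ∈ X. Let 𝓑 be a nonempty finite set of balls, each B ∈ 𝓑 with center c_B ∈ X, radius r_B ≥ 0, value v_B ∈ ℝ, and confidence radius conf_B ≥ 0 satisfying the clean-run condition |v_B − μ(c_B)| ≤ r_B + conf_B. Define I^pre(B) = v_B + r_B + conf_B and I(B) = r_B + min_{B'∈𝓑} (I^pre(B') + D(c_B, c_{B'})). Suppose S ∈ 𝓑 has a parent P ∈ 𝓑 with r_P = 2·r_S, D(c_S, c_P) ≤ r_P, and conf_P ≤ r_P. Then for every x ∈ X with D(x, c_S) ≤ r_S, it holds that I(S) ≤ μ(x) + 14·r_S. -/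
/-- In a clean run, if the ball `S ∈ 𝓑` has a parent `P ∈ 𝓑` with
`r_P = 2·r_S`, `D(c_S, c_P) ≤ r_P` and `conf_P ≤ r_P`, then for every context `x`
in `S` (i.e. `D(x, c_S) ≤ r_S`) the index satisfies `I(S) ≤ μ(x) + 14·r_S`. -/
theorem stmt6
    {X : Type*} [MetricSpace X] (μ : X → ℝ)
    (hLip : ∀ x x' : X, |μ x - μ x'| ≤ dist x x')
    {ι : Type*} [Fintype ι] [Nonempty ι]
    (c : ι → X) (r : ι → ℝ) (v : ι → ℝ) (conf : ι → ℝ)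
    (hr : ∀ B, 0 ≤ r B) (hconf : ∀ B, 0 ≤ conf B)
    (hclean : ∀ B, |v B - μ (c B)| ≤ r B + conf B)
    (Ipre : ι → ℝ) (hIpre : ∀ B, Ipre B = v B + r B + conf B)
    (I : ι → ℝ)
    (hI : ∀ B, I B = r B +
      Finset.univ.inf' Finset.univ_nonempty (fun B' => Ipre B' + dist (c B) (c B')))
    (S P : ι) (hrP : r P = 2 * r S)
    (hparent_dist : dist (c S) (c P) ≤ r P) (hparent_conf : conf P ≤ r P) :
    ∀ x : X, dist x (c S) ≤ r S → I S ≤ μ x + 14 * r S := by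
  intro x hx
  have hmin : Finset.univ.inf' Finset.univ_nonempty (fun B' => Ipre B' + dist (c S) (c B')) ≤
      Ipre P + dist (c S) (c P) :=
    Finset.inf'_le (fun B' => Ipre B' + dist (c S) (c B')) (Finset.mem_univ P)
  have hv := (abs_le.mp (hclean P)).2
  have hSP := (abs_le.mp (hLip (c S) (c P))).1
  have hxS := (abs_le.mp (hLip x (c S))).1
  rw [hI S]
  linarith [hIpre P]
end

section
/- Let (X, D) be a metric space and let μ₁, μ₂ : X → ℝ be 1-Lipschitz functions (|μ_j(x) − μ_j(x')| ≤ D(x,x') for j = 1,2 and all x, x'). For j = 1, 2 let 𝓑_j be a nonempty finite set of balls, each B with center c_B ∈ X, radius r_B ≥ 0, value v_B ∈ ℝ, and confidence radius conf_B ≥ 0 satisfying |v_B − μ_j(c_B)| ≤ r_B + conf_B for every B ∈ 𝓑_j; define for each j the pre-index I^pre_j(B) = v_B + r_B + conf_B and the index I_j(B) = r_B + min_{B'∈𝓑_j} (I^pre_j(B') + D(c_B, c_{B'})). Fix a context x ∈ X. Suppose S ∈ 𝓑₁ satisfies D(x, c_S) ≤ r_S and has a parent P ∈ 𝓑₁ with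 r_P = 2·r_S, D(c_S, c_P) ≤ r_P, conf_P ≤ r_P; suppose S* ∈ 𝓑₂ satisfies D(x, c_{S*}) ≤ r_{S*}; and suppose I₁(S) ≥ I₂(S*). Then μ₂(x) − μ₁(x) ≤ 14·r_S. -/
/-- Two-arm index comparison in a clean run. If the selected arm's ball
`S` (containing the context `x`, with a parent `P` of radius `r_P = 2·r_S`,
`D(c_S, c_P) ≤ r_P`, `conf_P ≤ r_P`) has index at least that of the optimal arm's
relevant ball `S*` (also containing `x`), then `μ₂(x) − μ₁(x) ≤ 14·r_S`. -/
theorem stmt7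
    {X : Type*} [MetricSpace X] (μ₁ μ₂ : X → ℝ)
    (hLip₁ : ∀ x x' : X, |μ₁ x - μ₁ x'| ≤ dist x x')
    (hLip₂ : ∀ x x' : X, |μ₂ x - μ₂ x'| ≤ dist x x')
    {ι₁ ι₂ : Type*} [Fintype ι₁] [Nonempty ι₁] [Fintype ι₂] [Nonempty ι₂]
    (c₁ : ι₁ → X) (r₁ : ι₁ → ℝ) (v₁ : ι₁ → ℝ) (conf₁ : ι₁ → ℝ)
    (c₂ : ι₂ → X) (r₂ : ι₂ → ℝ) (v₂ : ι₂ → ℝ) (conf₂ : ι₂ → ℝ)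
    (hr₁ : ∀ B, 0 ≤ r₁ B) (hconf₁ : ∀ B, 0 ≤ conf₁ B)
    (hr₂ : ∀ B, 0 ≤ r₂ B) (hconf₂ : ∀ B, 0 ≤ conf₂ B)
    (hclean₁ : ∀ B, |v₁ B - μ₁ (c₁ B)| ≤ r₁ B + conf₁ B)
    (hclean₂ : ∀ B, |v₂ B - μ₂ (c₂ B)| ≤ r₂ B + conf₂ B)
    (Ipre₁ : ι₁ → ℝ) (hIpre₁ : ∀ B, Ipre₁ B = v₁ B + r₁ B + conf₁ B)
    (Ipre₂ : ι₂ → ℝ) (hIpre₂ : ∀ B, Ipre₂ B = v₂ B + r₂ B + conf₂ B)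
    (I₁ : ι₁ → ℝ)
    (hI₁ : ∀ B, I₁ B = r₁ B +
      Finset.univ.inf' Finset.univ_nonempty (fun B' => Ipre₁ B' + dist (c₁ B) (c₁ B')))
    (I₂ : ι₂ → ℝ)
    (hI₂ : ∀ B, I₂ B = r₂ B +
      Finset.univ.inf' Finset.univ_nonempty (fun B' => Ipre₂ B' + dist (c₂ B) (c₂ B')))
    (x : X) (S : ι₁) (hxS : dist x (c₁ S) ≤ r₁ S)
    (P : ι₁) (hrP : r₁ P = 2 * r₁ S)
    (hparent_dist : dist (c₁ S) (c₁ P) ≤ r₁ P) (hparent_conf : conf₁ P ≤ r₁ P)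
    (Sstar : ι₂) (hxSstar : dist x (c₂ Sstar) ≤ r₂ Sstar)
    (hsel : I₂ Sstar ≤ I₁ S) :
    μ₂ x - μ₁ x ≤ 14 * r₁ S := by
  have hupper : I₁ S ≤ r₁ S + (Ipre₁ P + dist (c₁ S) (c₁ P)) := by
    rw [hI₁]
    gcongr
    exact Finset.inf'_le (fun B' => Ipre₁ B' + dist (c₁ S) (c₁ B')) (Finset.mem_univ P)
  have hlower : r₂ Sstar + μ₂ (c₂ Sstar) ≤ I₂ Sstar := by
    rw [hI₂]
    gcongr
    refine Finset.le_inf' _ _ fun B _ => ?_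
    have hclean := (abs_le.mp (hclean₂ B)).1
    have hLip := (abs_le.mp (hLip₂ (c₂ Sstar) (c₂ B))).2
    linarith [hIpre₂ B]
  have hx₂ := (abs_le.mp (hLip₂ x (c₂ Sstar))).2
  have hx₁ := (abs_le.mp (hLip₁ x (c₁ S))).1
  have hSP := (abs_le.mp (hLip₁ (c₁ S) (c₁ P))).1
  have hcleanP := (abs_le.mp (hclean₁ P)).2
  linarith [hIpre₁ P]
end

section
/- Let (X, D) be a metric space and let μ₁, μ₂ : X → ℝ be 1-Lipschitz functions (|μ_j(x) − μ_j(x')| ≤ D(x,x') for j = 1,2 and all x, x'). For j = 1, 2 let 𝓑_j be a nonempty finite set of balls, each B with center c_B ∈ X, radius r_B ≥ 0, value v_B ∈ ℝ, and confidence radius conf_B ≥ 0 satisfying |v_B − μ_j(c_B)| ≤ r_B + conf_B for every B ∈ 𝓑_j; define for each j the pre-index I^pre_j(B) = v_B + r_B + conf_B and the index I_j(B) = r_B + min_{B'∈𝓑_j} (I^pre_j(B') + D(c_B, c_{B'})). Fix a context x ∈ X. Suppose S ∈ 𝓑₁ satisfies D(x, c_S) ≤ r_S and conf_S ≤ r_S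 (i.e., S is a parent ball, having just activated a child ball of radius r_S/2); suppose S* ∈ 𝓑₂ satisfies D(x, c_{S*}) ≤ r_{S*}; and suppose I₁(S) ≥ I₂(S*). Then μ₂(x) − μ₁(x) ≤ 6·r_S = 12·(r_S/2); in particular, if a ball of radius ρ = r_S/2 is activated at context x with parent S, then μ₂(x) − μ₁(x) ≤ 12·ρ. -/
/-- Two-arm index comparison in a clean run when the selected ball `S`
is itself a parent ball (`conf_S ≤ r_S`). If `S` contains the context `x` and its
index is at least that of the optimal arm's relevant ball `S*` containing `x`, then
`μ₂(x) − μ₁(x) ≤ 6·r_S = 12·(r_S/2)`; in particular a ball of radius `r_S/2`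
activated at `x` with parent `S` satisfies `μ₂(x) − μ₁(x) ≤ 12·(r_S/2)`. -/
theorem stmt8
    {X : Type*} [MetricSpace X] (μ₁ μ₂ : X → ℝ)
    (hLip₁ : ∀ x x' : X, |μ₁ x - μ₁ x'| ≤ dist x x')
    (hLip₂ : ∀ x x' : X, |μ₂ x - μ₂ x'| ≤ dist x x')
    {ι₁ ι₂ : Type*} [Fintype ι₁] [Nonempty ι₁] [Fintype ι₂] [Nonempty ι₂]
    (c₁ : ι₁ → X) (r₁ : ι₁ → ℝ) (v₁ : ι₁ → ℝ) (conf₁ : ι₁ → ℝ)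
    (c₂ : ι₂ → X) (r₂ : ι₂ → ℝ) (v₂ : ι₂ → ℝ) (conf₂ : ι₂ → ℝ)
    (hr₁ : ∀ B, 0 ≤ r₁ B) (hconf₁ : ∀ B, 0 ≤ conf₁ B)
    (hr₂ : ∀ B, 0 ≤ r₂ B) (hconf₂ : ∀ B, 0 ≤ conf₂ B)
    (hclean₁ : ∀ B, |v₁ B - μ₁ (c₁ B)| ≤ r₁ B + conf₁ B)
    (hclean₂ : ∀ B, |v₂ B - μ₂ (c₂ B)| ≤ r₂ B + conf₂ B)
    (Ipre₁ : ι₁ → ℝ) (hIpre₁ : ∀ B, Ipre₁ B = v₁ B + r₁ B + conf₁ B)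
    (Ipre₂ : ι₂ → ℝ) (hIpre₂ : ∀ B, Ipre₂ B = v₂ B + r₂ B + conf₂ B)
    (I₁ : ι₁ → ℝ)
    (hI₁ : ∀ B, I₁ B = r₁ B +
      Finset.univ.inf' Finset.univ_nonempty (fun B' => Ipre₁ B' + dist (c₁ B) (c₁ B')))
    (I₂ : ι₂ → ℝ)
    (hI₂ : ∀ B, I₂ B = r₂ B +
      Finset.univ.inf' Finset.univ_nonempty (fun B' => Ipre₂ B' + dist (c₂ B) (c₂ B')))
    (x : X) (S : ι₁) (hxS : dist x (c₁ S) ≤ r₁ S)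
    (hSparent : conf₁ S ≤ r₁ S)
    (Sstar : ι₂) (hxSstar : dist x (c₂ Sstar) ≤ r₂ Sstar)
    (hsel : I₂ Sstar ≤ I₁ S) :
    μ₂ x - μ₁ x ≤ 6 * r₁ S ∧ (6 : ℝ) * r₁ S = 12 * (r₁ S / 2) := by
  refine ⟨?_, by ring⟩
  have h_upper : I₁ S ≤ μ₁ x + 6 * r₁ S := by
    have h_inf := Finset.inf'_le (fun B' => Ipre₁ B' + dist (c₁ S) (c₁ B')) (Finset.mem_univ S)
    simp only [dist_self, add_zero] at h_inf
    have h_lip := (abs_le.mp (hLip₁ x (c₁ S))).1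
    have h_clean := (abs_le.mp (hclean₁ S)).2
    linarith [hI₁ S, hIpre₁ S]
  have h_lower : μ₂ x ≤ I₂ Sstar := by
    have h_inf : μ₂ (c₂ Sstar) ≤ Finset.univ.inf' Finset.univ_nonempty
        (fun B' => Ipre₂ B' + dist (c₂ Sstar) (c₂ B')) := by
      refine Finset.le_inf' _ _ fun B' _ => ?_
      have h_lip := (abs_le.mp (hLip₂ (c₂ Sstar) (c₂ B'))).2
      have h_clean := (abs_le.mp (hclean₂ B')).1
      linarith [hIpre₂ B']
    have h_lip := (abs_le.mp (hLip₂ x (c₂ Sstar))).2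
    linarith [hI₂ Sstar]
  linarith
end
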